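/- arXiv:math/0501319 — 2 statements merged into one kernel-verified Lean document; each statement's English description precedes it below -/
import Mathlib

section
/- There exist ε₀ > 0 and c* > 0, depending only on n, σ₀ and finitely many of the constants A_ℓ, such that if ε ∈ (0, ε₀), 0 < c₀ ≤ c*, and α = (α_x, α_ξ) ∈ ℝⁿ × ℝⁿ satisfies 1/2 ≤ |α_ξ| ≤ 2 and α_x·α_ξ ≤ −c₀ ⟨α_x⟩ |α_ξ|, then, setting g(s,c) = x(s,α)·α_ξ − c ⟨x(s,α)⟩ |α_ξ| for s ≥ 0 and c ∈ I := [c₀/10, c₀/2]: (i) for every c ∈ I the map s ↦ g(s,c) is strictly increasing on [0,∞) (indeed ∂g/∂s ≥ 1/10); (ii) for every c ∈ I there exists a unique θ(c) > 0 with g(θ(c),c) = 0; (iii) c ↦ θ(c) is strictly increasing on I; (iv) there is a unique θ* > 0 with x(θ*,α)·α_ξ = 0, and for every c ∈ I, (3/2)|θ(c) − θ*| |α_ξ| ≤ |x(θ(c),α) − x(θ*,α)| ≤ 3 |θ(c) − θ*| |α_ξ|; (v) |θ(c) − θ*| ≥ c₀/120 for every c ∈ I; (vi) for every c ∈ [c₀/3,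 c₀/2], (c/10) ⟨x(θ*,α)⟩ ≤ |θ(c) − θ*| ≤ 4c ⟨x(θ*,α)⟩. -/
open MeasureTheory Set
open scoped BigOperators

noncomputable section

namespace Paper

/-- `ℝⁿ` with the Euclidean norm. -/
abbrev Eu (n : ℕ) := EuclideanSpace ℝ (Fin n)

/-- The Japanese bracket `⟨x⟩ = (1 + |x|²)^{1/2}`. -/
def jb {n : ℕ} (x : Eu n) : ℝ := Real.sqrt (1 + ‖x‖ ^ 2)

/-- `⟨t⟩ = (1 + t²)^{1/2}` for a real number `t`. -/
def jbr (t : ℝ) : ℝ := Real.sqrt (1 + t ^ 2)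

/-- The dot product `x·ξ` on `ℝⁿ`. -/
def dotp {n : ℕ} (x ξ : Eu n) : ℝ := ∑ j, x j * ξ j

/-- First-order partial derivative `∂/∂xᵢ`. -/
def pd {n : ℕ} (i : Fin n) (f : Eu n → ℝ) : Eu n → ℝ :=
  fun x => fderiv ℝ f x (EuclideanSpace.single i 1)

/-- The list of coordinate directions attached to a multi-index `γ`. -/
def mIdx {n : ℕ} (γ : Fin n → ℕ) : List (Fin n) :=
  (List.finRange n).foldr (fun i acc => List.replicate (γ i) i ++ acc) []

/-- The multi-index partial derivative `∂^γ` of a function on `ℝⁿ`. -/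
def mderiv {n : ℕ} (γ : Fin n → ℕ) (f : Eu n → ℝ) : Eu n → ℝ :=
  (mIdx γ).foldr pd f

/-- The order `|γ|` of a multi-index. -/
def mOrd {n : ℕ} (γ : Fin n → ℕ) : ℕ := ∑ i, γ i

/-- Partial derivative in the first group of variables of a function `f(x,ξ)`. -/
def pdX {n : ℕ} (i : Fin n) (f : Eu n → Eu n → ℝ) : Eu n → Eu n → ℝ :=
  fun x ξ => fderiv ℝ (fun y => f y ξ) x (EuclideanSpace.single i 1)

/-- Partial derivative in the second group of variables of a function `f(x,ξ)`. -/
def pdXi {n : ℕ} (i : Fin n) (f : Eu n → Eu n → ℝ) : Eu n → Eu n → ℝ :=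
  fun x ξ => fderiv ℝ (fun η => f x η) ξ (EuclideanSpace.single i 1)

/-- The mixed multi-index derivative `∂_x^A ∂_ξ^B` of a function `f(x,ξ)`. -/
def mderiv2 {n : ℕ} (A B : Fin n → ℕ) (f : Eu n → Eu n → ℝ) : Eu n → Eu n → ℝ :=
  (mIdx A).foldr pdX ((mIdx B).foldr pdXi f)

theorem dotp_eq_inner {n : ℕ} (x ξ : Eu n) : dotp x ξ = inner ℝ x ξ := by
  simp [dotp, PiLp.inner_apply, mul_comm]

theorem one_le_jb {n : ℕ} (x : Eu n) : 1 ≤ jb x :=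
  Real.one_le_sqrt.2 (by nlinarith [sq_nonneg ‖x‖])

theorem jb_sq {n : ℕ} (x : Eu n) : jb x ^ 2 = 1 + ‖x‖ ^ 2 :=
  Real.sq_sqrt (by positivity)

theorem norm_le_jb {n : ℕ} (x : Eu n) : ‖x‖ ≤ jb x :=
  Real.le_sqrt_of_sq_le (by linarith)

theorem jb_le_add_norm_sub {n : ℕ} (x y : Eu n) : jb x ≤ jb y + ‖x - y‖ := by
  have hy := norm_le_jb y
  have hxy : ‖x‖ ≤ ‖y‖ + ‖x - y‖ := by simpa using norm_add_le y (x - y)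
  refine Real.sqrt_le_iff.2 ⟨by linarith [one_le_jb y, norm_nonneg (x - y)], ?_⟩
  nlinarith [jb_sq y, norm_nonneg x, norm_nonneg y, norm_nonneg (x - y)]

theorem hasDerivAt_jb_comp {n : ℕ} {x : ℝ → Eu n} {x' : Eu n} {t : ℝ} (h : HasDerivAt x x' t) :
    HasDerivAt (fun s => jb (x s)) (inner ℝ (x t) x' / jb (x t)) t := by
  have h1 := (h.norm_sq.const_add 1).sqrt (by positivity)
  rw [mul_div_mul_left _ _ two_ne_zero] at h1
  exact h1

theorem norm_le_card_mul_of_abs_le {n : ℕ} {w : Eu n} {M : ℝ}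
    (h : ∀ j, |w j| ≤ M) : ‖w‖ ≤ n * M := by
  have hw : w = ∑ j, EuclideanSpace.single j (w j) := by
    ext i
    simp [Pi.single_apply]
  calc ‖w‖ = ‖∑ j, EuclideanSpace.single j (w j)‖ := by rw [← hw]
    _ ≤ ∑ j : Fin n, ‖EuclideanSpace.single j (w j)‖ := norm_sum_le _ _
    _ ≤ ∑ _j : Fin n, M := Finset.sum_le_sum fun j _ => by simpa using h j
    _ = n * M := by simp

theorem abs_apply_le_norm {n : ℕ} (w : Eu n) (j : Fin n) : |w j| ≤ ‖w‖ := by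
  simpa using PiLp.norm_apply_le w j

theorem mderiv_zero {n : ℕ} (f : Eu n → ℝ) : mderiv 0 f = f := by
  simp [mderiv, mIdx]

theorem mderiv_single {n : ℕ} (i : Fin n) (f : Eu n → ℝ) :
    mderiv (Pi.single i 1) f = pd i f := by
  have h0 : ∀ l : List (Fin n), i ∉ l → l.foldr
      (fun k acc => List.replicate ((Pi.single i 1 : Fin n → ℕ) k) k ++ acc) [] = [] := by
    intro l
    induction l with
    | nil => intro _; rfl
    | cons a l ih =>
      intro hl
      simp only [List.mem_cons, not_or] at hl
      simp [ih hl.2, Pi.single_eq_of_ne (Ne.symm hl.1)]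
  have h1 : ∀ l : List (Fin n), l.Nodup → i ∈ l → l.foldr
      (fun k acc => List.replicate ((Pi.single i 1 : Fin n → ℕ) k) k ++ acc) [] = [i] := by
    intro l
    induction l with
    | nil => intro _ h; simp at h
    | cons a l ih =>
      intro hn hl
      rw [List.nodup_cons] at hn
      by_cases hai : a = i
      · subst hai
        simp [h0 l hn.1]
      · have hil : i ∈ l := by simpa [Ne.symm hai] using hl
        simp [ih hn.2 hil, Pi.single_eq_of_ne hai]
  simp [mderiv, mIdx, h1 _ (List.nodup_finRange n) (List.mem_finRange i)]

theorem abs_fderiv_quadratic_sub_le {n : ℕ} (B : Fin n → Fin n → ℝ) {ε M : ℝ} (hε : 0 ≤ ε)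
    (hB : ∑ j, ∑ k, |B j k| ≤ M) (ξ : Eu n) (m : Fin n) :
    |fderiv ℝ (fun η : Eu n => ‖η‖ ^ 2 + ε * ∑ j, ∑ k, B j k * η j * η k) ξ
      (EuclideanSpace.single m 1) - 2 * ξ m| ≤ 2 * (ε * M) * ‖ξ‖ := by
  have hj : ∀ j, HasFDerivAt (fun η : Eu n => η j) (EuclideanSpace.proj j : Eu n →L[ℝ] ℝ) ξ :=
    fun j => (EuclideanSpace.proj j : Eu n →L[ℝ] ℝ).hasFDerivAt
  have hq := ((hasStrictFDerivAt_norm_sq ξ).hasFDerivAt).add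
    ((HasFDerivAt.fun_sum (u := Finset.univ) fun j _ => HasFDerivAt.fun_sum (u := Finset.univ)
      fun k _ => ((hj j).const_mul (B j k)).mul (hj k)).const_mul ε)
  have hterm : ∀ j k, |B j k * ξ j * (EuclideanSpace.single m (1 : ℝ) : Eu n) k +
      ξ k * (B j k * (EuclideanSpace.single m (1 : ℝ) : Eu n) j)| ≤ |B j k| * (2 * ‖ξ‖) := by
    intro j k
    have he : ∀ i, |(EuclideanSpace.single m (1 : ℝ) : Eu n) i| ≤ 1 := fun i => by
      simpa using abs_apply_le_norm (EuclideanSpace.single m (1 : ℝ) : Eu n) i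
    refine (abs_add_le _ _).trans ?_
    simp only [abs_mul]
    have h1 : |ξ j| * |(EuclideanSpace.single m (1 : ℝ) : Eu n) k| ≤ ‖ξ‖ * 1 :=
      mul_le_mul (abs_apply_le_norm ξ j) (he k) (abs_nonneg _) (norm_nonneg _)
    have h2 : |ξ k| * |(EuclideanSpace.single m (1 : ℝ) : Eu n) j| ≤ ‖ξ‖ * 1 :=
      mul_le_mul (abs_apply_le_norm ξ k) (he j) (abs_nonneg _) (norm_nonneg _)
    nlinarith [abs_nonneg (B j k)]
  have hsum : |∑ j, ∑ k, (B j k * ξ j * (EuclideanSpace.single m (1 : ℝ) : Eu n) k +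
      ξ k * (B j k * (EuclideanSpace.single m (1 : ℝ) : Eu n) j))| ≤ M * (2 * ‖ξ‖) := by
    refine (Finset.abs_sum_le_sum_abs _ _).trans ?_
    calc _ ≤ ∑ j, ∑ k, |B j k| * (2 * ‖ξ‖) := Finset.sum_le_sum fun j _ =>
          (Finset.abs_sum_le_sum_abs _ _).trans (Finset.sum_le_sum fun k _ => hterm j k)
      _ = (∑ j, ∑ k, |B j k|) * (2 * ‖ξ‖) := by simp only [Finset.sum_mul]
      _ ≤ M * (2 * ‖ξ‖) := by gcongr
  have hval : fderiv ℝ (fun η : Eu n => ‖η‖ ^ 2 + ε * ∑ j, ∑ k, B j k * η j * η k) ξ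
      (EuclideanSpace.single m 1) - 2 * ξ m =
      ε * ∑ j, ∑ k, (B j k * ξ j * (EuclideanSpace.single m (1 : ℝ) : Eu n) k +
      ξ k * (B j k * (EuclideanSpace.single m (1 : ℝ) : Eu n) j)) := by
    have := hq.fderiv
    erw [this]
    simp [EuclideanSpace.inner_single_right]
  rw [hval, abs_mul, abs_of_nonneg hε]
  nlinarith [mul_le_mul_of_nonneg_left hsum hε]

theorem abs_fderiv_coeff_le {n : ℕ} {b : Fin n → Fin n → Eu n → ℝ} {ε M : ℝ} (hε : 0 ≤ ε)
    {x : Eu n} (hb : ∀ j k, DifferentiableAt ℝ (b j k) x) (m : Fin n)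
    (hM : ∑ j, ∑ k, |pd m (b j k) x| ≤ M) (ξ : Eu n) (K : ℝ) :
    |fderiv ℝ (fun y : Eu n => K + ε * ∑ j, ∑ k, b j k y * ξ j * ξ k) x
      (EuclideanSpace.single m 1)| ≤ ε * M * ‖ξ‖ ^ 2 := by
  have hq := ((HasFDerivAt.fun_sum (u := Finset.univ) fun j _ =>
    HasFDerivAt.fun_sum (u := Finset.univ) fun k _ =>
      (((hb j k).hasFDerivAt.mul_const (ξ j)).mul_const (ξ k))).const_mul ε).const_add K
  have hval : fderiv ℝ (fun y : Eu n => K + ε * ∑ j, ∑ k, b j k y * ξ j * ξ k) x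
      (EuclideanSpace.single m 1) = ε * ∑ j, ∑ k, ξ k * (ξ j * pd m (b j k) x) := by
    rw [hq.fderiv]
    simp [pd]
  have hsum : |∑ j, ∑ k, ξ k * (ξ j * pd m (b j k) x)| ≤ M * ‖ξ‖ ^ 2 := by
    refine (Finset.abs_sum_le_sum_abs _ _).trans ?_
    calc _ ≤ ∑ j, ∑ k, |pd m (b j k) x| * ‖ξ‖ ^ 2 := Finset.sum_le_sum fun j _ =>
          (Finset.abs_sum_le_sum_abs _ _).trans (Finset.sum_le_sum fun k _ => by
            rw [abs_mul, abs_mul]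
            have := mul_le_mul (abs_apply_le_norm ξ k) (abs_apply_le_norm ξ j) (abs_nonneg _)
              (norm_nonneg _)
            nlinarith [abs_nonneg (pd m (b j k) x)])
      _ = (∑ j, ∑ k, |pd m (b j k) x|) * ‖ξ‖ ^ 2 := by simp only [Finset.sum_mul]
      _ ≤ M * ‖ξ‖ ^ 2 := by gcongr
  rw [hval, abs_mul, abs_of_nonneg hε, mul_assoc]
  exact mul_le_mul_of_nonneg_left hsum hε

theorem continuous_induction_le {u : ℝ → ℝ} (hu : Continuous u) {η : ℝ} (h0 : u 0 < η)
    (hstep : ∀ T, 0 ≤ T → (∀ t ∈ Icc 0 T, u t ≤ η) → u T < η) {T : ℝ} (hT : 0 ≤ T) :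
    u T ≤ η := by
  by_contra! hlt
  have hK : IsCompact (Icc 0 T ∩ u ⁻¹' {η}) :=
    isCompact_Icc.inter_right (isClosed_singleton.preimage hu)
  obtain ⟨t₀, ht₀, hut₀⟩ := intermediate_value_Icc hT hu.continuousOn ⟨h0.le, hlt.le⟩
  obtain ⟨t₁, ⟨ht₁, hut₁⟩, hmin⟩ := hK.exists_isLeast ⟨t₀, ht₀, hut₀⟩
  have hle : ∀ t ∈ Icc 0 t₁, u t ≤ η := by
    intro t ht
    by_contra! hgt
    obtain ⟨s, hs, hus⟩ := intermediate_value_Icc ht.1 hu.continuousOn ⟨h0.le, hgt.le⟩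
    have h1 : t₁ ≤ s := hmin ⟨⟨hs.1, hs.2.trans (ht.2.trans ht₁.2)⟩, hus⟩
    have h2 : s = t := le_antisymm hs.2 (ht.2.trans h1)
    rw [h2] at hus
    exact hgt.ne' hus
  exact (hstep t₁ ht₁.1 hle).ne hut₁

theorem exists_unique_pos_zero {g : ℝ → ℝ} (hg : Continuous g) (h0 : g 0 < 0)
    (hgrow : ∀ s t, 0 ≤ s → s ≤ t → 1 / 10 * (t - s) ≤ g t - g s) :
    ∃ θ, 0 < θ ∧ g θ = 0 ∧ ∀ t, 0 < t → g t = 0 → t = θ := by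
  have hT : (0 : ℝ) ≤ -10 * g 0 := by linarith
  obtain ⟨θ, hθ, hgθ⟩ := intermediate_value_Icc hT hg.continuousOn
    (show (0 : ℝ) ∈ Icc _ _ from ⟨h0.le, by linarith [hgrow 0 _ le_rfl hT]⟩)
  have hθ0 : 0 < θ := lt_of_le_of_ne hθ.1 (by rintro rfl; linarith)
  refine ⟨θ, hθ0, hgθ, fun t ht hgt => ?_⟩
  rcases le_total t θ with h | h
  · linarith [hgrow t θ ht.le h]
  · linarith [hgrow θ t hθ0.le h]

theorem abs_inner_sub_two_mul_sq_le {n : ℕ} {w v : Eu n} {a δ : ℝ} (h : ‖w - (2 * a) • v‖ ≤ δ) :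
    |inner ℝ w v - 2 * a * ‖v‖ ^ 2| ≤ δ * ‖v‖ := by
  have h1 : inner ℝ w v - 2 * a * ‖v‖ ^ 2 = inner ℝ (w - (2 * a) • v) v := by
    rw [inner_sub_left, inner_smul_left, real_inner_self_eq_norm_sq]
    simp
  rw [h1]
  exact (abs_real_inner_le_norm _ _).trans (by gcongr)

/-- A bootstrap for the momentum `ξ`: as long as `ξ` stays near `v`, the position moves along `v`
with speed bounded below, so the force, which decays like `⟨x⟩⁻²`, has a small time integral. -/
theorem norm_velocity_sub_le {n : ℕ} {x x' ξ ξ' : ℝ → Eu n} {v : Eu n} {κ : ℝ}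
    (hx : ∀ t, HasDerivAt x (x' t) t) (hξ : ∀ t, HasDerivAt ξ (ξ' t) t) (hξ0 : ξ 0 = v)
    (hv : 1 / 2 ≤ ‖v‖) (hv' : ‖v‖ ≤ 2) (hκ0 : 0 ≤ κ) (hκ : κ ≤ 1 / 10000)
    (hx' : ∀ t, ‖x' t - (2 : ℝ) • ξ t‖ ≤ κ * ‖ξ t‖)
    (hξ' : ∀ t, ‖ξ' t‖ ≤ κ / jb (x t) ^ 2 * ‖ξ t‖ ^ 2) {t : ℝ} (ht : 0 ≤ t) :
    ‖x' t - (2 : ℝ) • v‖ ≤ 1 / 25 := by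
  have hv0 : 0 < ‖v‖ := by linarith
  have hnear : ∀ t, ‖ξ t - v‖ ≤ 1 / 100 → ‖ξ t‖ ≤ 3 ∧ ‖x' t - (2 : ℝ) • v‖ ≤ 1 / 25 := by
    intro t h
    have h3 : ‖ξ t‖ ≤ 3 := by
      have : ‖ξ t‖ ≤ ‖v‖ + ‖ξ t - v‖ := by simpa using norm_add_le v (ξ t - v)
      linarith
    refine ⟨h3, ?_⟩
    have h4 : ‖x' t - (2 : ℝ) • v‖ ≤ ‖x' t - (2 : ℝ) • ξ t‖ + 2 * ‖ξ t - v‖ := by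
      have := norm_add_le (x' t - (2 : ℝ) • ξ t) ((2 : ℝ) • (ξ t - v))
      rw [norm_smul, Real.norm_two, smul_sub, sub_add_sub_cancel] at this
      exact this
    have h5 := hx' t
    nlinarith [norm_nonneg (ξ t)]
  refine (hnear t ?_).2
  have hcont : Continuous fun t => ‖ξ t - v‖ :=
    ((continuous_iff_continuousAt.2 fun t => (hξ t).continuousAt).sub continuous_const).norm
  refine continuous_induction_le hcont (by simp [hξ0]) (fun T hT hle => ?_) ht
  have hf : ∀ t, HasDerivAt (fun s => inner ℝ (x s) v / ‖v‖) (inner ℝ (x' t) v / ‖v‖) t := by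
    intro t
    have := (hx t).inner ℝ (hasDerivAt_const t v)
    simp only [inner_zero_right, zero_add] at this
    exact this.div_const _
  have hB := fun t => ((((hf t).arctan).sub_const
    (Real.arctan (inner ℝ (x 0) v / ‖v‖))).const_mul (9 * κ / ‖v‖))
  have hmain := image_norm_le_of_norm_deriv_right_le_deriv_boundary (f := fun t => ξ t - v)
    (f' := ξ') (a := 0) (b := T)
    ((continuous_iff_continuousAt.2 fun t => (hξ t).continuousAt).sub
      continuous_const).continuousOn
    (fun t _ => ((hξ t).sub_const v).hasDerivWithinAt) (by simp [hξ0]) hB ?_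
  · have hlast := hmain ⟨hT, le_rfl⟩
    refine hlast.trans_lt ?_
    have h1 := Real.arctan_lt_pi_div_two (inner ℝ (x T) v / ‖v‖)
    have h2 := Real.neg_pi_div_two_lt_arctan (inner ℝ (x 0) v / ‖v‖)
    have h3 := Real.pi_lt_d2
    have h4 : 9 * κ / ‖v‖ ≤ 18 / 10000 := by
      rw [div_le_iff₀ hv0]
      nlinarith
    have h5 : 0 ≤ 9 * κ / ‖v‖ := by positivity
    nlinarith
  · intro t ht
    obtain ⟨h3, hvel⟩ := hnear t (hle t ⟨ht.1, ht.2.le⟩)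
    have hin := abs_le.1 (abs_inner_sub_two_mul_sq_le (a := 1) (by simpa using hvel))
    have hspeed : 1 ≤ inner ℝ (x' t) v / ‖v‖ / ‖v‖ := by
      rw [le_div_iff₀ hv0, le_div_iff₀ hv0]
      nlinarith
    have hpos : (inner ℝ (x t) v / ‖v‖) ^ 2 ≤ ‖x t‖ ^ 2 := by
      rw [sq_le_sq, abs_div, abs_norm, abs_norm, div_le_iff₀ hv0]
      exact abs_real_inner_le_norm _ _
    have hjb := jb_sq (x t)
    calc ‖ξ' t‖ ≤ κ / jb (x t) ^ 2 * ‖ξ t‖ ^ 2 := hξ' t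
      _ ≤ κ / jb (x t) ^ 2 * 3 ^ 2 := by gcongr
      _ = 9 * κ * (1 / jb (x t) ^ 2) * 1 := by ring
      _ ≤ 9 * κ * (1 / (1 + (inner ℝ (x t) v / ‖v‖) ^ 2)) *
          (inner ℝ (x' t) v / ‖v‖ / ‖v‖) := by
        gcongr
        linarith
      _ = _ := by
        field_simp

/-- The conclusion of `statement11` for a curve whose velocity stays within `1/25` of `2v`. -/
theorem exists_crossing_times {n : ℕ} {x x' : ℝ → Eu n} {v : Eu n}
    (hx : ∀ t, HasDerivAt x (x' t) t) (hv : 1 / 2 ≤ ‖v‖) (hv' : ‖v‖ ≤ 2)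
    (hvel : ∀ t, 0 ≤ t → ‖x' t - (2 : ℝ) • v‖ ≤ 1 / 25)
    {c₀ : ℝ} (hc₀ : 0 < c₀) (hc₀' : c₀ ≤ 1 / 10) (h0 : dotp (x 0) v ≤ -c₀ * jb (x 0) * ‖v‖) :
    ∃ (θ : ℝ → ℝ) (θs : ℝ),
      (∀ c ∈ Icc (c₀ / 10) (c₀ / 2),
        StrictMonoOn (fun s => dotp (x s) v - c * jb (x s) * ‖v‖) (Ici (0 : ℝ)) ∧
          ∀ s : ℝ, 0 ≤ s → 1 / 10 ≤ deriv (fun u => dotp (x u) v - c * jb (x u) * ‖v‖) s) ∧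
      (∀ c ∈ Icc (c₀ / 10) (c₀ / 2),
        0 < θ c ∧ dotp (x (θ c)) v - c * jb (x (θ c)) * ‖v‖ = 0 ∧
          ∀ t : ℝ, 0 < t → dotp (x t) v - c * jb (x t) * ‖v‖ = 0 → t = θ c) ∧
      StrictMonoOn θ (Icc (c₀ / 10) (c₀ / 2)) ∧
      (0 < θs ∧ dotp (x θs) v = 0 ∧ ∀ t : ℝ, 0 < t → dotp (x t) v = 0 → t = θs) ∧
      (∀ c ∈ Icc (c₀ / 10) (c₀ / 2),
        3 / 2 * |θ c - θs| * ‖v‖ ≤ ‖x (θ c) - x θs‖ ∧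
          ‖x (θ c) - x θs‖ ≤ 3 * |θ c - θs| * ‖v‖) ∧
      (∀ c ∈ Icc (c₀ / 10) (c₀ / 2), c₀ / 120 ≤ |θ c - θs|) ∧
      (∀ c ∈ Icc (c₀ / 3) (c₀ / 2),
        c / 10 * jb (x θs) ≤ |θ c - θs| ∧ |θ c - θs| ≤ 4 * c * jb (x θs)) := by
  have hv0 : 0 < ‖v‖ := by linarith
  have hdisp : ∀ s t, 0 ≤ s → s ≤ t →
      ‖(x t - x s) - (2 * (t - s)) • v‖ ≤ 1 / 25 * (t - s) := by
    intro s t hs hst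
    have h := Convex.norm_image_sub_le_of_norm_hasDerivWithin_le (𝕜 := ℝ)
      (f := fun u => x u - (2 * u) • v)
      (f' := fun u => x' u - (2 : ℝ) • v) (s := Ici (0 : ℝ)) (C := 1 / 25) (x := s) (y := t)
      (fun u _ => ((hx u).sub (by
        simpa using ((hasDerivAt_id u).const_mul 2).smul_const v)).hasDerivWithinAt)
      (fun u hu => hvel u hu) (convex_Ici 0) hs (hs.trans hst)
    rw [Real.norm_of_nonneg (sub_nonneg.2 hst)] at h
    have heq : (x t - x s) - (2 * (t - s)) • v = x t - (2 * t) • v - (x s - (2 * s) • v) := by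
      rw [mul_sub, sub_smul]
      abel
    rwa [heq]
  have hdist : ∀ s t, 0 ≤ s → s ≤ t →
      |‖x t - x s‖ - 2 * (t - s) * ‖v‖| ≤ 1 / 25 * (t - s) := by
    intro s t hs hst
    have h := (abs_norm_sub_norm_le (x t - x s) ((2 * (t - s)) • v)).trans (hdisp s t hs hst)
    rwa [norm_smul, Real.norm_of_nonneg (by linarith)] at h
  have hdot : ∀ s t, 0 ≤ s → s ≤ t →
      |dotp (x t) v - dotp (x s) v - 2 * (t - s) * ‖v‖ ^ 2| ≤ 1 / 25 * (t - s) * ‖v‖ := by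
    intro s t hs hst
    have h := abs_inner_sub_two_mul_sq_le (hdisp s t hs hst)
    rwa [inner_sub_left, ← dotp_eq_inner, ← dotp_eq_inner] at h
  have hgrow : ∀ c, 0 ≤ c → c ≤ 1 / 20 → ∀ s t, 0 ≤ s → s ≤ t → 1 / 10 * (t - s) ≤
      (dotp (x t) v - c * jb (x t) * ‖v‖) - (dotp (x s) v - c * jb (x s) * ‖v‖) := by
    intro c hc hc' s t hs hst
    have h1 := (abs_le.1 (hdot s t hs hst)).1
    have h2 := (abs_le.1 (hdist s t hs hst)).2
    have h3 : jb (x t) - jb (x s) ≤ (2 * ‖v‖ + 1 / 25) * (t - s) := by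
      linarith [jb_le_add_norm_sub (x t) (x s)]
    have h4 : c * (jb (x t) - jb (x s)) ≤ 1 / 20 * ((2 * ‖v‖ + 1 / 25) * (t - s)) :=
      (mul_le_mul_of_nonneg_left h3 hc).trans
        (mul_le_mul_of_nonneg_right hc' (mul_nonneg (by positivity) (sub_nonneg.2 hst)))
    have h5 := mul_le_mul_of_nonneg_right h4 hv0.le
    have h6 : 1 / 10 ≤ 2 * ‖v‖ ^ 2 - 1 / 25 * ‖v‖ - 1 / 20 * (2 * ‖v‖ + 1 / 25) * ‖v‖ := by
      nlinarith
    have h7 := mul_le_mul_of_nonneg_right h6 (sub_nonneg.2 hst)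
    nlinarith
  have hg' : ∀ c s, HasDerivAt (fun u => dotp (x u) v - c * jb (x u) * ‖v‖)
      (inner ℝ (x' s) v - c * (inner ℝ (x s) (x' s) / jb (x s)) * ‖v‖) s := by
    intro c s
    have h := (hx s).inner ℝ (hasDerivAt_const s v)
    simp only [inner_zero_right, zero_add, ← dotp_eq_inner] at h
    rw [← dotp_eq_inner]
    exact h.sub (((hasDerivAt_jb_comp (hx s)).const_mul c).mul_const _)
  have hg0 : ∀ c, 0 ≤ c → dotp (x 0) v - c * jb (x 0) * ‖v‖ < 0 := by
    intro c hc
    have h1 : 0 < jb (x 0) * ‖v‖ := mul_pos (by linarith [one_le_jb (x 0)]) hv0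
    nlinarith [mul_nonneg hc h1.le, mul_pos hc₀ h1]
  have hex : ∀ c, ∃ θ, 0 ≤ c → c ≤ 1 / 20 → 0 < θ ∧
      dotp (x θ) v - c * jb (x θ) * ‖v‖ = 0 ∧
      ∀ t, 0 < t → dotp (x t) v - c * jb (x t) * ‖v‖ = 0 → t = θ := by
    intro c
    by_cases hc : 0 ≤ c ∧ c ≤ 1 / 20
    · obtain ⟨θ, hθ⟩ := exists_unique_pos_zero
        (continuous_iff_continuousAt.2 fun s => (hg' c s).continuousAt) (hg0 c hc.1)
        (hgrow c hc.1 hc.2)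
      exact ⟨θ, fun _ _ => hθ⟩
    · exact ⟨0, fun h h' => absurd ⟨h, h'⟩ hc⟩
  choose θ hθ using hex
  have hmono : ∀ c d, 0 ≤ c → c < d → d ≤ 1 / 20 → θ c < θ d := by
    intro c d hc hcd hd
    obtain ⟨hc1, hc2, -⟩ := hθ c hc (hcd.le.trans hd)
    obtain ⟨hd1, hd2, -⟩ := hθ d (hc.trans hcd.le) hd
    by_contra! hle
    have h1 := hgrow d (hc.trans hcd.le) hd _ _ hd1.le hle
    have h2 : 0 < jb (x (θ c)) * ‖v‖ := mul_pos (by linarith [one_le_jb (x (θ c))]) hv0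
    nlinarith
  have hrange : ∀ c ∈ Icc (c₀ / 10) (c₀ / 2), 0 < c ∧ c ≤ 1 / 20 := fun c hc =>
    ⟨by linarith [hc.1], by linarith [hc.2]⟩
  obtain ⟨hs1, hs2, hs3⟩ := hθ 0 le_rfl (by norm_num)
  simp only [zero_mul, sub_zero] at hs2 hs3
  have hτ : ∀ c, 0 < c → c ≤ 1 / 20 → |θ c - θ 0| = θ c - θ 0 ∧ 0 < θ c - θ 0 := by
    intro c hc hc'
    have := sub_pos.2 (hmono 0 c le_rfl hc hc')
    exact ⟨abs_of_pos this, this⟩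
  have hcross : ∀ c, 0 < c → c ≤ 1 / 20 →
      |c * jb (x (θ c)) - 2 * (θ c - θ 0) * ‖v‖| ≤ 1 / 25 * (θ c - θ 0) := by
    intro c hc hc'
    have h := hdot (θ 0) (θ c) hs1.le (sub_pos.1 (hτ c hc hc').2).le
    have h2 := (hθ c hc.le hc').2.1
    have h3 : dotp (x (θ c)) v - dotp (x (θ 0)) v - 2 * (θ c - θ 0) * ‖v‖ ^ 2 =
        (c * jb (x (θ c)) - 2 * (θ c - θ 0) * ‖v‖) * ‖v‖ := by
      rw [hs2]
      linear_combination h2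
    rw [h3, abs_mul, abs_norm] at h
    exact le_of_mul_le_mul_right h hv0
  refine ⟨θ, θ 0, fun c hc => ⟨fun s hs t ht hst => ?_, fun s hs => ?_⟩, fun c hc => ?_,
    fun c hc d hd hcd => ?_, ⟨hs1, hs2, hs3⟩, fun c hc => ?_, fun c hc => ?_, fun c hc => ?_⟩
  · have := hgrow c (hrange c hc).1.le (hrange c hc).2 s t hs hst.le
    simp only
    linarith
  · obtain ⟨hc1, hc2⟩ := hrange c hc
    rw [(hg' c s).deriv]
    have h1 := (abs_le.1 (abs_inner_sub_two_mul_sq_le (a := 1) (by simpa using hvel s hs))).1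
    have hj := one_le_jb (x s)
    have h2 : ‖x' s‖ ≤ 2 * ‖v‖ + 1 / 25 := by
      have := norm_add_le ((2 : ℝ) • v) (x' s - (2 : ℝ) • v)
      rw [add_sub_cancel, norm_smul, Real.norm_two] at this
      linarith [hvel s hs]
    have h3 : inner ℝ (x s) (x' s) / jb (x s) ≤ 2 * ‖v‖ + 1 / 25 := by
      rw [div_le_iff₀ (by linarith)]
      have h4 := real_inner_le_norm (x s) (x' s)
      have h5 := mul_le_mul (norm_le_jb (x s)) h2 (norm_nonneg _) (by linarith)
      linarith
    have h6 : c * (inner ℝ (x s) (x' s) / jb (x s)) ≤ 1 / 20 * (2 * ‖v‖ + 1 / 25) :=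
      (mul_le_mul_of_nonneg_left h3 hc1.le).trans (mul_le_mul_of_nonneg_right hc2 (by positivity))
    have h7 := mul_le_mul_of_nonneg_right h6 hv0.le
    nlinarith
  · exact hθ c (hrange c hc).1.le (hrange c hc).2
  · exact hmono c d (hrange c hc).1.le hcd (hrange d hd).2
  · obtain ⟨hc1, hc2⟩ := hrange c hc
    obtain ⟨h1, h2⟩ := hτ c hc1 hc2
    have h3 := abs_le.1 (hdist (θ 0) (θ c) hs1.le (sub_pos.1 h2).le)
    rw [h1]
    constructor <;> nlinarith
  · obtain ⟨hc1, hc2⟩ := hrange c hc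
    obtain ⟨h1, h2⟩ := hτ c hc1 hc2
    have h3 := abs_le.1 (hcross c hc1 hc2)
    have h4 := one_le_jb (x (θ c))
    rw [h1]
    nlinarith [hc.1]
  · obtain ⟨hc1, hc2⟩ := hrange c ⟨by linarith [hc.1], hc.2⟩
    obtain ⟨h1, h2⟩ := hτ c hc1 hc2
    have h3 := abs_le.1 (hcross c hc1 hc2)
    have h4 := abs_le.1 (hdist (θ 0) (θ c) hs1.le (sub_pos.1 h2).le)
    have h5 := jb_le_add_norm_sub (x (θ c)) (x (θ 0))
    have h6 := jb_le_add_norm_sub (x (θ 0)) (x (θ c))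
    rw [norm_sub_rev] at h6
    have h7 : ‖x (θ c) - x (θ 0)‖ ≤ 5 * (θ c - θ 0) := by nlinarith
    have h8 : c * ‖x (θ c) - x (θ 0)‖ ≤ 1 / 20 * (5 * (θ c - θ 0)) :=
      mul_le_mul hc2 h7 (norm_nonneg _) (by norm_num)
    have h9 := mul_le_mul_of_nonneg_left h5 hc1.le
    have h10 := mul_le_mul_of_nonneg_left h6 hc1.le
    rw [h1]
    constructor <;> nlinarith

theorem exists_hasDerivAt_of_apply {n : ℕ} {x : ℝ → Eu n} {x' : ℝ → Fin n → ℝ}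
    (h : ∀ t j, HasDerivAt (fun s => x s j) (x' t j) t) :
    ∃ y : ℝ → Eu n, (∀ t, HasDerivAt x (y t) t) ∧ ∀ t j, y t j = x' t j := by
  have hd : ∀ t, HasDerivAt x (deriv x t) t := fun t =>
    (differentiableAt_euclidean.2 fun j => (h t j).differentiableAt).hasDerivAt
  refine ⟨deriv x, hd, fun t j => HasDerivAt.unique ?_ (h t j)⟩
  exact (EuclideanSpace.proj j : Eu n →L[ℝ] ℝ).hasFDerivAt.comp_hasDerivAt t (hd t)

/-- **Lemma IV.4.18.** There are `ε₀ > 0`, `c* > 0` such that if `ε ∈ (0,ε₀)`,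
`0 < c₀ ≤ c*`, `1/2 ≤ |α_ξ| ≤ 2` and `α_x·α_ξ ≤ −c₀⟨α_x⟩|α_ξ|`, then with
`g(s,c) = x(s,α)·α_ξ − c⟨x(s,α)⟩|α_ξ|` and `I = [c₀/10, c₀/2]`:
(i) `s ↦ g(s,c)` is strictly increasing on `[0,∞)` with `∂g/∂s ≥ 1/10`;
(ii) for each `c ∈ I` there is a unique `θ(c) > 0` with `g(θ(c),c)=0`;
(iii) `θ` is strictly increasing on `I`;
(iv) there is a unique `θ* > 0` with `x(θ*,α)·α_ξ = 0` and
`(3/2)|θ(c)−θ*||α_ξ| ≤ |x(θ(c),α) − x(θ*,α)| ≤ 3|θ(c)−θ*||α_ξ|`;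
(v) `|θ(c)−θ*| ≥ c₀/120` on `I`;
(vi) `(c/10)⟨x(θ*,α)⟩ ≤ |θ(c)−θ*| ≤ 4c⟨x(θ*,α)⟩` for `c ∈ [c₀/3, c₀/2]`. -/
theorem statement11
    (n : ℕ) (hn : 1 ≤ n) (σ₀ : ℝ) (hσ₀ : 0 < σ₀) (hσ₀' : σ₀ < 1)
    (A : ℕ → ℝ) (hApos : ∀ ℓ, 0 < A ℓ) :
    ∃ ε₀ cstar : ℝ, 0 < ε₀ ∧ 0 < cstar ∧
      ∀ b : Fin n → Fin n → Eu n → ℝ,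
        (∀ j k, ContDiff ℝ (⊤ : ℕ∞) (b j k)) →
        (∀ (ℓ : ℕ) (x : Eu n),
          (∑ γ ∈ Finset.Nat.antidiagonalTuple n ℓ, ∑ j, ∑ k, |mderiv γ (b j k) x|) ≤
            A ℓ * jb x ^ (-(1 + (ℓ : ℝ) + σ₀))) →
      ∀ ε : ℝ, 0 < ε → ε < ε₀ → ε * A 0 ≤ 1 / 10 →
      ∀ p : Eu n → Eu n → ℝ,
        (∀ x ξ, p x ξ = ‖ξ‖ ^ 2 + ε * ∑ j, ∑ k, b j k x * ξ j * ξ k) →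
      ∀ Xf Ξf : ℝ → Eu n → Eu n → Eu n,
        ContDiff ℝ (⊤ : ℕ∞)
          (fun q : ℝ × Eu n × Eu n => (Xf q.1 q.2.1 q.2.2, Ξf q.1 q.2.1 q.2.2)) →
        (∀ (t : ℝ) (x ξ : Eu n) (j : Fin n),
          HasDerivAt (fun s => Xf s x ξ j)
            (fderiv ℝ (fun η => p (Xf t x ξ) η) (Ξf t x ξ)
              (EuclideanSpace.single j 1)) t) →
        (∀ (t : ℝ) (x ξ : Eu n) (j : Fin n),
          HasDerivAt (fun s => Ξf s x ξ j)
            (-(fderiv ℝ (fun y => p y (Ξf t x ξ)) (Xf t x ξ)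
              (EuclideanSpace.single j 1))) t) →
        (∀ x ξ, Xf 0 x ξ = x) → (∀ x ξ, Ξf 0 x ξ = ξ) →
      ∀ c₀ : ℝ, 0 < c₀ → c₀ ≤ cstar →
      ∀ αx αξ : Eu n, 1 / 2 ≤ ‖αξ‖ → ‖αξ‖ ≤ 2 → dotp αx αξ ≤ -c₀ * jb αx * ‖αξ‖ →
      ∃ (θ : ℝ → ℝ) (θs : ℝ),
        (∀ c ∈ Icc (c₀ / 10) (c₀ / 2),
          StrictMonoOn (fun s => dotp (Xf s αx αξ) αξ - c * jb (Xf s αx αξ) * ‖αξ‖)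
              (Ici (0 : ℝ)) ∧
            ∀ s : ℝ, 0 ≤ s →
              1 / 10 ≤
                deriv (fun u => dotp (Xf u αx αξ) αξ - c * jb (Xf u αx αξ) * ‖αξ‖) s) ∧
        (∀ c ∈ Icc (c₀ / 10) (c₀ / 2),
          0 < θ c ∧
            dotp (Xf (θ c) αx αξ) αξ - c * jb (Xf (θ c) αx αξ) * ‖αξ‖ = 0 ∧
            ∀ t : ℝ, 0 < t →
              dotp (Xf t αx αξ) αξ - c * jb (Xf t αx αξ) * ‖αξ‖ = 0 → t = θ c) ∧
        StrictMonoOn θ (Icc (c₀ / 10) (c₀ / 2)) ∧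
        (0 < θs ∧ dotp (Xf θs αx αξ) αξ = 0 ∧
          ∀ t : ℝ, 0 < t → dotp (Xf t αx αξ) αξ = 0 → t = θs) ∧
        (∀ c ∈ Icc (c₀ / 10) (c₀ / 2),
          3 / 2 * |θ c - θs| * ‖αξ‖ ≤ ‖Xf (θ c) αx αξ - Xf θs αx αξ‖ ∧
            ‖Xf (θ c) αx αξ - Xf θs αx αξ‖ ≤ 3 * |θ c - θs| * ‖αξ‖) ∧
        (∀ c ∈ Icc (c₀ / 10) (c₀ / 2), c₀ / 120 ≤ |θ c - θs|) ∧
        (∀ c ∈ Icc (c₀ / 3) (c₀ / 2),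
          c / 10 * jb (Xf θs αx αξ) ≤ |θ c - θs| ∧
            |θ c - θs| ≤ 4 * c * jb (Xf θs αx αξ)) := by
  have hn0 : (0 : ℝ) < n := by exact_mod_cast hn
  have hA0 := hApos 0
  have hA1 := hApos 1
  refine ⟨1 / (20000 * n * (A 0 + A 1)), 1 / 10, by positivity, by norm_num, ?_⟩
  intro b hb hbA ε hε hε' _ p hp Xf Ξf _ hX hΞ hX0 hΞ0 c₀ hc₀ hc₀' αx αξ hα hα' hdot
  obtain ⟨x', hx', hx'_apply⟩ := exists_hasDerivAt_of_apply fun t j => hX t αx αξ j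
  obtain ⟨ξ', hξ', hξ'_apply⟩ := exists_hasDerivAt_of_apply fun t j => hΞ t αx αξ j
  have hκ : 2 * n * ε * (A 0 + A 1) ≤ 1 / 10000 := by
    rw [lt_div_iff₀ (by positivity)] at hε'
    linarith
  have hjb0 : ∀ x : Eu n, ∑ j, ∑ k, |b j k x| ≤ A 0 := by
    intro x
    have h := hbA 0 x
    simp only [Finset.Nat.antidiagonalTuple_zero_right, Finset.sum_singleton, mderiv_zero] at h
    exact h.trans (mul_le_of_le_one_right hA0.le
      (Real.rpow_le_one_of_one_le_of_nonpos (one_le_jb x) (by norm_num; linarith)))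
  have hjb1 : ∀ (x : Eu n) (m : Fin n), ∑ j, ∑ k, |pd m (b j k) x| ≤ A 1 / jb x ^ 2 := by
    intro x m
    have hmem : Pi.single m 1 ∈ Finset.Nat.antidiagonalTuple n 1 := by
      simp [Finset.Nat.mem_antidiagonalTuple]
    have h := (Finset.single_le_sum (f := fun γ => ∑ j, ∑ k, |mderiv γ (b j k) x|)
      (fun γ _ => Finset.sum_nonneg fun j _ => Finset.sum_nonneg fun k _ => abs_nonneg _)
      hmem).trans (hbA 1 x)
    simp only [mderiv_single] at h
    refine h.trans ?_
    rw [div_eq_mul_inv, ← Real.rpow_natCast, ← Real.rpow_neg (by linarith [one_le_jb x])]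
    gcongr
    · exact one_le_jb x
    · push_cast
      linarith
  have hpx : ∀ x, (fun η => p x η) =
      fun η : Eu n => ‖η‖ ^ 2 + ε * ∑ j, ∑ k, b j k x * η j * η k := fun x => funext (hp x)
  have hpξ : ∀ ξ, (fun y => p y ξ) =
      fun y : Eu n => ‖ξ‖ ^ 2 + ε * ∑ j, ∑ k, b j k y * ξ j * ξ k :=
    fun ξ => funext fun y => hp y ξ
  have hvel : ∀ t, 0 ≤ t → ‖x' t - (2 : ℝ) • αξ‖ ≤ 1 / 25 := by
    intro t ht
    refine norm_velocity_sub_le hx' hξ' (hΞ0 αx αξ) hα hα' (by positivity) hκ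
      (fun t => ?_) (fun t => ?_) ht
    · refine (norm_le_card_mul_of_abs_le (M := 2 * (ε * A 0) * ‖Ξf t αx αξ‖) fun j => ?_).trans ?_
      · simpa [hx'_apply, hpx] using
          abs_fderiv_quadratic_sub_le (fun j k => b j k (Xf t αx αξ)) hε.le (hjb0 _)
            (Ξf t αx αξ) j
      · have : 0 ≤ 2 * n * ε * A 1 * ‖Ξf t αx αξ‖ := by positivity
        linarith
    · refine (norm_le_card_mul_of_abs_le
        (M := ε * (A 1 / jb (Xf t αx αξ) ^ 2) * ‖Ξf t αx αξ‖ ^ 2) fun j => ?_).trans ?_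
      · rw [hξ'_apply, abs_neg, hpξ]
        exact abs_fderiv_coeff_le hε.le
          (fun j k => ((hb j k).differentiable (by simp)).differentiableAt) j (hjb1 _ j) _ _
      · have : 0 ≤ n * ε * (2 * A 0 + A 1) / jb (Xf t αx αξ) ^ 2 * ‖Ξf t αx αξ‖ ^ 2 := by
          positivity
        linear_combination this
  exact exists_crossing_times hx' hα hα' hvel hc₀ hc₀' (by rwa [hX0])

end Paper
end
end

section
/- Let n ≥ 1, let 0 ≤ T < θ be real numbers, and let Y : [T,θ] → ℂⁿ be C¹. Let h, g : [T,θ] → ℝ be continuous and assume that for all t ∈ [T,θ]: |Y'(t) − (2/(2t−i)) Y(t)| ≤ |h(t)| |Y(t)| + |g(t)|. Then for all t ∈ [T,θ]: |Y(t)| ≤ ( (⟨2t⟩/⟨2θ⟩) |Y(θ)| + ⟨2t⟩ ∫_T^θ |g(s)|/⟨2s⟩ ds ) · exp( ∫_T^θ |h(s)| ds ). -/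
open Set

noncomputable section

namespace Paper

/-- Backward integral Grönwall inequality for functions continuous on the line. -/
theorem le_mul_exp_of_le_add_integral {a b A : ℝ} {p q : ℝ → ℝ}
    (hp : Continuous p) (hq : Continuous q) (hp0 : ∀ t, 0 ≤ p t)
    (hle : ∀ t ∈ Icc a b, q t ≤ A + ∫ s in t..b, p s * q s) {t : ℝ} (ht : t ∈ Icc a b) :
    q t ≤ A * Real.exp (∫ s in t..b, p s) := by
  have hab : a ≤ b := ht.1.trans ht.2
  have hderiv : ∀ {f : ℝ → ℝ}, Continuous f → ∀ x,
      HasDerivAt (fun u => ∫ s in u..b, f s) (-f x) x := fun hf x =>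
    intervalIntegral.integral_hasDerivAt_left (hf.intervalIntegrable _ _)
      (hf.stronglyMeasurableAtFilter _ _) hf.continuousAt
  set W : ℝ → ℝ := fun u =>
    (A + ∫ s in u..b, p s * q s) * Real.exp (-∫ s in u..b, p s) with hW
  have hW' : ∀ x, HasDerivAt W
      (p x * ((A + ∫ s in x..b, p s * q s) - q x) * Real.exp (-∫ s in x..b, p s)) x := by
    intro x
    have := ((hderiv (hp.mul hq) x).const_add A).mul (hderiv hp x).neg.exp
    exact this.congr_deriv (by simp only [Pi.mul_apply, Pi.neg_apply]; ring)
  have hmono : MonotoneOn W (Icc a b) := by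
    refine monotoneOn_of_deriv_nonneg (convex_Icc a b)
      (fun x _ => (hW' x).continuousAt.continuousWithinAt)
      (fun x _ => (hW' x).differentiableAt.differentiableWithinAt) fun x hx => ?_
    rw [(hW' x).deriv]
    exact mul_nonneg (mul_nonneg (hp0 x) (sub_nonneg.2 (hle x (interior_subset hx))))
      (Real.exp_pos _).le
  have hWt : W t ≤ A := by
    simpa [hW] using hmono ht (right_mem_Icc.2 hab) ht.2
  calc q t ≤ A + ∫ s in t..b, p s * q s := hle t ht
    _ = W t * Real.exp (∫ s in t..b, p s) := by
      rw [hW]; simp only; rw [mul_assoc, ← Real.exp_add]; simp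
    _ ≤ A * Real.exp (∫ s in t..b, p s) := by gcongr

/-- Backward differential Grönwall inequality for vector-valued functions. -/
theorem norm_le_mul_exp_of_norm_deriv_le {E : Type*} [NormedAddCommGroup E] [NormedSpace ℝ E]
    [CompleteSpace E] {a b : ℝ} {Z Z' : ℝ → E} {p g : ℝ → ℝ}
    (hZ : ∀ t ∈ Icc a b, HasDerivWithinAt Z (Z' t) (Icc a b) t)
    (hZ' : ContinuousOn Z' (Icc a b))
    (hp : ContinuousOn p (Icc a b)) (hg : ContinuousOn g (Icc a b))
    (hp0 : ∀ t, 0 ≤ p t) (hg0 : ∀ t, 0 ≤ g t)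
    (hle : ∀ t ∈ Icc a b, ‖Z' t‖ ≤ p t * ‖Z t‖ + g t) {t : ℝ} (ht : t ∈ Icc a b) :
    ‖Z t‖ ≤ (‖Z b‖ + ∫ s in a..b, g s) * Real.exp (∫ s in a..b, p s) := by
  have hab : a ≤ b := ht.1.trans ht.2
  have hZc : ContinuousOn Z (Icc a b) := fun x hx => (hZ x hx).continuousWithinAt
  have hII : ∀ {f : ℝ → ℝ}, ContinuousOn f (Icc a b) → ∀ u ∈ Icc a b,
      IntervalIntegrable f MeasureTheory.volume u b := fun hf u hu =>
    (hf.mono (Icc_subset_Icc_left hu.1)).intervalIntegrable_of_Icc hu.2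
  have hmono : ∀ {f : ℝ → ℝ}, ContinuousOn f (Icc a b) → (∀ x, 0 ≤ f x) → ∀ u ∈ Icc a b,
      ∫ s in u..b, f s ≤ ∫ s in a..b, f s := fun hf hf0 u hu =>
    intervalIntegral.integral_mono_interval hu.1 hu.2 le_rfl
      (Filter.Eventually.of_forall hf0) (hII hf a (left_mem_Icc.2 hab))
  set P : ℝ → ℝ := fun x => p (projIcc a b hab x) with hP
  set Q : ℝ → ℝ := fun x => ‖Z (projIcc a b hab x)‖ with hQ
  have hproj : ∀ x ∈ Icc a b, (projIcc a b hab x : ℝ) = x := fun x hx => by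
    rw [projIcc_of_mem hab hx]
  have hPc : Continuous P :=
    hp.comp_continuous (continuous_subtype_val.comp continuous_projIcc) fun x => Subtype.prop _
  have hQc : Continuous Q :=
    hZc.norm.comp_continuous (continuous_subtype_val.comp continuous_projIcc)
      fun x => Subtype.prop _
  have key : ∀ u ∈ Icc a b, Q u ≤ (‖Z b‖ + ∫ s in a..b, g s) + ∫ s in u..b, P s * Q s := by
    intro u hu
    have hsub : Icc u b ⊆ Icc a b := Icc_subset_Icc_left hu.1
    have hftc : ∫ s in u..b, Z' s = Z b - Z u :=
      intervalIntegral.integral_eq_sub_of_hasDerivAt_of_le hu.2 (hZc.mono hsub)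
        (fun x hx => (hZ x (hsub (Ioo_subset_Icc_self hx))).hasDerivAt
          (Icc_mem_nhds (hu.1.trans_lt hx.1) hx.2))
        ((hZ'.mono hsub).intervalIntegrable_of_Icc hu.2)
    have hbound : ‖∫ s in u..b, Z' s‖ ≤ ∫ s in u..b, (P s * Q s + g s) := by
      refine intervalIntegral.norm_integral_le_of_norm_le hu.2
        (Filter.Eventually.of_forall fun s hs => ?_)
        (((hPc.mul hQc).intervalIntegrable _ _).add (hII hg u hu))
      have hs' : s ∈ Icc a b := hsub (Ioc_subset_Icc_self hs)
      simpa only [hP, hQ, hproj s hs'] using hle s hs'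
    rw [intervalIntegral.integral_add (f := fun s => P s * Q s)
        ((hPc.mul hQc).intervalIntegrable _ _) (hII hg u hu)]
      at hbound
    have hQu : Q u = ‖Z u‖ := by simp only [hQ, hproj u hu]
    have htri : ‖Z u‖ ≤ ‖Z b‖ + ‖Z b - Z u‖ := by
      simpa using norm_sub_le (Z b) (Z b - Z u)
    rw [← hftc] at htri
    linarith [hmono hg hg0 u hu]
  have hfinal := le_mul_exp_of_le_add_integral hPc hQc (fun x => hp0 _) key ht
  have hPp : ∫ s in t..b, P s = ∫ s in t..b, p s := by
    refine intervalIntegral.integral_congr fun s hs => ?_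
    rw [uIcc_of_le ht.2] at hs
    simp only [hP, hproj s (Icc_subset_Icc_left ht.1 hs)]
  have hQt : Q t = ‖Z t‖ := by simp only [hQ, hproj t ht]
  rw [hPp, hQt] at hfinal
  have hA : 0 ≤ ‖Z b‖ + ∫ s in a..b, g s :=
    add_nonneg (norm_nonneg _) (intervalIntegral.integral_nonneg hab fun s _ => hg0 s)
  refine hfinal.trans ?_
  gcongr
  exact hmono hp hp0 t ht

theorem jbr_pos (t : ℝ) : 0 < jbr t := Real.sqrt_pos.2 (by positivity)

theorem continuous_jbr : Continuous jbr := by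
  unfold jbr
  fun_prop

theorem norm_ofReal_sub_I (t : ℝ) : ‖(t : ℂ) - Complex.I‖ = jbr t := by
  rw [Complex.norm_def, Complex.normSq_apply, jbr]
  congr 1
  simp
  ring

/-- **Lemma V.3.6.** Let `0 ≤ T < θ` and `Y : [T,θ] → ℂⁿ` be `C¹` with
`|Y'(t) − (2/(2t−i)) Y(t)| ≤ |h(t)||Y(t)| + |g(t)|` for continuous `h, g`. Then
`|Y(t)| ≤ ((⟨2t⟩/⟨2θ⟩)|Y(θ)| + ⟨2t⟩ ∫_T^θ |g(s)|/⟨2s⟩ ds) exp(∫_T^θ |h(s)| ds)`. -/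
theorem statement16 (n : ℕ) (hn : 1 ≤ n) (T θ : ℝ) (hT : 0 ≤ T) (hTθ : T < θ)
    (Y Y' : ℝ → EuclideanSpace ℂ (Fin n))
    (hY'cont : ContinuousOn Y' (Icc T θ))
    (hYderiv : ∀ t ∈ Icc T θ, HasDerivWithinAt Y (Y' t) (Icc T θ) t)
    (h g : ℝ → ℝ) (hh : ContinuousOn h (Icc T θ)) (hg : ContinuousOn g (Icc T θ))
    (hineq : ∀ t ∈ Icc T θ,
      ‖Y' t - (2 / (2 * (t : ℂ) - Complex.I)) • Y t‖ ≤ |h t| * ‖Y t‖ + |g t|) :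
    ∀ t ∈ Icc T θ,
      ‖Y t‖ ≤
        (jbr (2 * t) / jbr (2 * θ) * ‖Y θ‖ +
            jbr (2 * t) * ∫ s in T..θ, |g s| / jbr (2 * s)) *
          Real.exp (∫ s in T..θ, |h s|) := by
  set c : ℝ → ℂ := fun t => 2 * (t : ℂ) - Complex.I with hc
  have hcn : ∀ t, ‖c t‖ = jbr (2 * t) := fun t => by
    simpa [hc] using norm_ofReal_sub_I (2 * t)
  have hc0 : ∀ t, c t ≠ 0 := fun t => norm_pos_iff.1 (by rw [hcn]; exact jbr_pos _)
  have hc' : ∀ t, HasDerivAt c 2 t := fun t => by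
    simpa [hc] using ((Complex.ofRealCLM.hasDerivAt (x := t)).const_mul 2).sub_const Complex.I
  have hcc : Continuous c := continuous_iff_continuousAt.2 fun t => (hc' t).continuousAt
  have hYc : ContinuousOn Y (Icc T θ) := fun x hx => (hYderiv x hx).continuousWithinAt
  have hjc : Continuous fun s : ℝ => jbr (2 * s) := continuous_jbr.comp (by fun_prop)
  have hZn : ∀ t, ‖(c t)⁻¹ • Y t‖ = ‖Y t‖ / jbr (2 * t) := fun t => by
    rw [norm_smul, norm_inv, hcn, inv_mul_eq_div]
  intro t ht
  have hmain := norm_le_mul_exp_of_norm_deriv_le (a := T) (b := θ)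
    (Z := fun s => (c s)⁻¹ • Y s)
    (Z' := fun s => (c s)⁻¹ • (Y' s - (2 / c s) • Y s))
    (p := fun s => |h s|) (g := fun s => |g s| / jbr (2 * s))
    (fun s hs => by
      refine (((hc' s).inv (hc0 s)).hasDerivWithinAt.smul (hYderiv s hs)).congr_deriv ?_
      rw [smul_sub, smul_smul, sub_eq_add_neg, ← neg_smul]
      congr 2
      have := hc0 s
      field_simp)
    ((hcc.inv₀ hc0).continuousOn.smul (hY'cont.sub
      ((continuous_const.div hcc hc0).continuousOn.smul hYc)))
    hh.abs (hg.abs.div hjc.continuousOn fun s _ => (jbr_pos _).ne')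
    (fun s => abs_nonneg _) (fun s => div_nonneg (abs_nonneg _) (jbr_pos _).le)
    (fun s hs => by
      rw [hZn, norm_smul, norm_inv, hcn, inv_mul_eq_div, ← mul_div_assoc, ← add_div]
      exact div_le_div_of_nonneg_right (hineq s hs) (jbr_pos _).le)
    ht
  simp only [hZn] at hmain
  rw [div_le_iff₀ (jbr_pos _)] at hmain
  refine hmain.trans_eq ?_
  ring

end Paper
end
end
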